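/- For integers p > q > 0, the quadrilateral 𝒴^{p,q} is a toric diagram with exactly four extreme points, and for any lattice segment L, the Minkowski sum 𝒴^{p,q} + L is a toric diagram if and only if L contains no lattice points other than its two endpoints and the edge vector of L is not parallel to any of the four vectors (1,0), (p−1,p), (−q−1,−q), (−p+q+1,−p+q) (the oriented edge vectors of 𝒴^{p,q}). -/

import Mathlib

open Set Pointwise

noncomputable section

/-- We work in the plane `ℝ × ℝ`. -/
abbrev V : Type := ℝ × ℝ

/-- The embedding of the lattice `ℤ × ℤ` into the plane. -/
def toR (p : ℤ × ℤ) : V := ((p.1 : ℝ), (p.2 : ℝ))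

/-- The set of lattice points of the plane. -/
def latticePoints : Set V := Set.range toR

/-- A lattice polytope: the convex hull of a nonempty finite set of lattice points. -/
def IsLatticePolytope (P : Set V) : Prop :=
  ∃ S : Finset (ℤ × ℤ), S.Nonempty ∧ P = convexHull ℝ (toR '' ↑S)

/-- A toric diagram: a two-dimensional lattice polytope such that every lattice point on its
topological boundary is an extreme point. -/
def IsToricDiagram (P : Set V) : Prop :=
  IsLatticePolytope P ∧ (interior P).Nonempty ∧
    ∀ x ∈ frontier P, x ∈ latticePoints → x ∈ P.extremePoints ℝ

/-- A lattice segment: the convex hull of two distinct lattice points. -/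
def IsLatticeSegment (L : Set V) : Prop :=
  ∃ a b : ℤ × ℤ, a ≠ b ∧ L = segment ℝ (toR a) (toR b)

/-- A lattice triangle: the convex hull of three affinely independent lattice points. -/
def IsLatticeTriangle (T : Set V) : Prop :=
  ∃ a b c : ℤ × ℤ, AffineIndependent ℝ ![toR a, toR b, toR c] ∧
    T = convexHull ℝ {toR a, toR b, toR c}

/-- `E` is an edge of `P`: a maximal (nondegenerate) line segment contained in the
topological boundary of `P`. -/
def IsEdge (P E : Set V) : Prop :=
  (∃ a b : V, a ≠ b ∧ E = segment ℝ a b) ∧ E ⊆ frontier P ∧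
    ∀ F : Set V, (∃ a b : V, F = segment ℝ a b) → F ⊆ frontier P → E ⊆ F → F = E

/-- `v` is an edge vector of `P` (the difference of the endpoints of some edge of `P`). -/
def IsEdgeVector (P : Set V) (v : V) : Prop :=
  ∃ a b : V, a ≠ b ∧ IsEdge P (segment ℝ a b) ∧ v = b - a

/-- Two plane vectors are parallel when their cross product vanishes. -/
def Par (v w : V) : Prop := v.1 * w.2 = v.2 * w.1

/-- `P` admits a lattice maximal Minkowski decomposition: `P` is a Minkowski sum of at
least two lattice polytopes, each of which is a lattice segment or a lattice triangle. -/
def HasLatticeMaximalDecomposition (P : Set V) : Prop :=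
  ∃ (m : ℕ) (Ps : Fin (m + 1) → Set V), 1 ≤ m ∧
    P = ∑ k, Ps k ∧ ∀ k, IsLatticeSegment (Ps k) ∨ IsLatticeTriangle (Ps k)

/-- A convex polytope: the convex hull of a nonempty finite set of points. -/
def IsConvexPolytope (A : Set V) : Prop :=
  ∃ S : Finset V, S.Nonempty ∧ A = convexHull ℝ (↑S : Set V)

/-- `A` is a homothet `λ • P + t` (`λ > 0`) of `P`. -/
def IsHomothet (A P : Set V) : Prop :=
  ∃ (l : ℝ) (t : V), 0 < l ∧ A = (fun x => l • x + t) '' P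

/-- A (nondegenerate) line segment. -/
def IsSegmentSet (A : Set V) : Prop := ∃ a b : V, a ≠ b ∧ A = segment ℝ a b

/-- A triangle: the convex hull of three affinely independent points. -/
def IsTriangleSet (A : Set V) : Prop :=
  ∃ a b c : V, AffineIndependent ℝ ![a, b, c] ∧ A = convexHull ℝ {a, b, c}

/-- A convex polytope is Minkowski-indecomposable if in every Minkowski decomposition
into two convex polytopes, one of the summands is a point or a homothet of the polytope. -/
def MinkowskiIndecomposable (Q : Set V) : Prop :=
  ∀ A B : Set V, IsConvexPolytope A → IsConvexPolytope B → Q = A + B →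
    (∃ x, A = {x}) ∨ IsHomothet A Q ∨ (∃ x, B = {x}) ∨ IsHomothet B Q

/-- A parallelogram: a quadrilateral whose vertices `v₁ v₂ v₃ v₄` in cyclic order satisfy
`v₁ + v₃ = v₂ + v₄`. -/
def IsParallelogram (P : Set V) : Prop :=
  ∃ w : Fin 4 → V, Function.Injective w ∧ P.extremePoints ℝ = Set.range w ∧
    w 0 + w 2 = w 1 + w 3

/-- The Gauntlett–Martelli–Sparks–Waldram toric diagram `𝒴^{p,q}`. -/
def GMSW (p q : ℤ) : Set V :=
  convexHull ℝ (toR '' ({(0, 0), (1, 0), (p, p), (p - q - 1, p - q)} : Set (ℤ × ℤ)))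

/-- Cross product of lattice vectors. -/
def crossZ (u w : ℤ × ℤ) : ℤ := u.1 * w.2 - u.2 * w.1

/-! ### Linear functionals on the plane -/

lemma toR_add (u v : ℤ × ℤ) : toR (u + v) = toR u + toR v := by
  simp [toR]

lemma toR_sub (u v : ℤ × ℤ) : toR (u - v) = toR u - toR v := by
  simp [toR]

lemma toR_injective : Function.Injective toR := by
  rintro ⟨a, b⟩ ⟨c, d⟩ h
  simpa [toR] using h

lemma clm_apply (f : V →L[ℝ] ℝ) (x : V) : f x = x.1 * f (1, 0) + x.2 * f (0, 1) := by
  have h : x = x.1 • ((1, 0) : V) + x.2 • ((0, 1) : V) := by ext <;> simp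
  conv_lhs => rw [h]
  simp only [map_add, map_smul, smul_eq_mul]

lemma clm_eq_zero {f : V →L[ℝ] ℝ} (h₁ : f (1, 0) = 0) (h₂ : f (0, 1) = 0) : f = 0 := by
  ext <;> simp [h₁, h₂]

/-- The linear functional with coefficients `α` and `β`. -/
def dual (α β : ℝ) : V →L[ℝ] ℝ :=
  α • ContinuousLinearMap.fst ℝ ℝ ℝ + β • ContinuousLinearMap.snd ℝ ℝ ℝ

lemma dual_apply (α β : ℝ) (x : V) : dual α β x = α * x.1 + β * x.2 := by
  simp [dual]

lemma dual_ne_zero {α β : ℝ} (h : α ≠ 0 ∨ β ≠ 0) : dual α β ≠ 0 := by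
  intro h0
  have h₁ := dual_apply α β (1, 0)
  have h₂ := dual_apply α β (0, 1)
  simp only [h0, zero_apply, mul_one, mul_zero, add_zero, zero_add] at h₁ h₂
  exact h.elim (fun h => h h₁.symm) (fun h => h h₂.symm)

lemma par_of_map_eq_zero {f : V →L[ℝ] ℝ} (hf : f ≠ 0) {u w : V} (hu : f u = 0) (hw : f w = 0) :
    Par u w := by
  rw [clm_apply] at hu hw
  unfold Par
  by_contra h
  have h' : u.1 * w.2 - u.2 * w.1 ≠ 0 := sub_ne_zero.2 h
  apply hf
  apply clm_eq_zero
  · apply mul_left_cancel₀ h'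
    linear_combination w.2 * hu - u.2 * hw
  · apply mul_left_cancel₀ h'
    linear_combination u.1 * hw - w.1 * hu

lemma Par.exists_smul_eq {u w : V} (h : Par u w) (hw : w ≠ 0) : ∃ k : ℝ, u = k • w := by
  unfold Par at h
  by_cases h₁ : w.1 = 0
  · have h₂ : w.2 ≠ 0 := fun h₂ => hw (Prod.ext h₁ h₂)
    refine ⟨u.2 / w.2, Prod.ext ?_ ?_⟩
    · simp only [Prod.smul_fst, smul_eq_mul, h₁, mul_zero]
      simpa [h₁, h₂] using h
    · simp [h₂]
  · refine ⟨u.1 / w.1, Prod.ext ?_ ?_⟩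
    · simp [h₁]
    · simp only [Prod.smul_snd, smul_eq_mul]
      field_simp
      linarith

/-! ### Maximizers of linear functionals on convex sets -/

section

variable {E : Type*} [NormedAddCommGroup E] [NormedSpace ℝ E]

/-- A maximizer of `f` over `convexHull ℝ S` lies in every convex set containing the maximizers
of `f` over `S`. -/
lemma mem_of_map_eq_max (f : E →L[ℝ] ℝ) {S C : Set E} (hC : Convex ℝ C) {M : ℝ}
    (hle : ∀ s ∈ S, f s ≤ M) (hmem : ∀ s ∈ S, f s = M → s ∈ C) {y : E}
    (hy : y ∈ convexHull ℝ S) (hM : f y = M) : y ∈ C := by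
  have hconv : Convex ℝ {y : E | f y ≤ M ∧ (f y = M → y ∈ C)} := by
    rw [convex_iff_forall_pos]
    rintro x ⟨hx, hxC⟩ z ⟨hz, hzC⟩ s t hs ht hst
    have hsx := mul_le_mul_of_nonneg_left hx hs.le
    have htz := mul_le_mul_of_nonneg_left hz ht.le
    have hsum : s * M + t * M = M := by rw [← add_mul, hst, one_mul]
    simp only [mem_ofPred_eq, map_add, map_smul, smul_eq_mul]
    refine ⟨by linarith, fun h => hC (hxC ?_) (hzC ?_) hs.le ht.le hst⟩
    · exact mul_left_cancel₀ hs.ne' (by linarith)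
    · exact mul_left_cancel₀ ht.ne' (by linarith)
  have hsub : S ⊆ {y : E | f y ≤ M ∧ (f y = M → y ∈ C)} := fun s hs => ⟨hle s hs, hmem s hs⟩
  exact (convexHull_min hsub hconv hy).2 hM

lemma map_le_of_mem_convexHull (f : E →L[ℝ] ℝ) {S : Set E} {M : ℝ} (hle : ∀ s ∈ S, f s ≤ M)
    {y : E} (hy : y ∈ convexHull ℝ S) : f y ≤ M :=
  convexHull_min (fun s hs => hle s hs) (convex_halfSpace_le f.toLinearMap.isLinear M) hy

lemma mem_frontier_of_isMaxOn {f : E →L[ℝ] ℝ} (hf : f ≠ 0) {P : Set E} {x : E} (hx : x ∈ P)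
    (hmax : IsMaxOn f P x) : x ∈ frontier P := by
  refine ⟨subset_closure hx, fun hint => hf ?_⟩
  exact (hmax.isLocalMax (mem_interior_iff_mem_nhds.1 hint)).hasFDerivAt_eq_zero f.hasFDerivAt

lemma exists_isMaxOn_of_mem_frontier {P : Set E} (hP : Convex ℝ P)
    (hint : (interior P).Nonempty) {x : E} (hx : x ∈ frontier P) :
    ∃ f : E →L[ℝ] ℝ, f ≠ 0 ∧ IsMaxOn f P x := by
  obtain ⟨f, hf⟩ := geometric_hahn_banach_open_point hP.interior isOpen_interior hx.2
  refine ⟨f, ?_, fun y hy => ?_⟩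
  · rintro rfl
    obtain ⟨z, hz⟩ := hint
    simpa using hf z hz
  · have hy' : y ∈ closure (interior P) := by
      rw [hP.closure_interior_eq_closure_of_nonempty_interior hint]
      exact subset_closure hy
    exact closure_minimal (fun z hz => (hf z hz).le) (isClosed_le f.continuous continuous_const) hy'

lemma mem_extremePoints_of_unique_max {f : E →L[ℝ] ℝ} {P : Set E} {x : E} (hx : x ∈ P)
    (hmax : IsMaxOn f P x) (huniq : ∀ y ∈ P, f y = f x → y = x) : x ∈ P.extremePoints ℝ := by
  refine mem_extremePoints_iff_left.2 ⟨hx, ?_⟩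
  rintro y hy z hz ⟨s, t, hs, ht, hst, hxyz⟩
  have hsy := mul_le_mul_of_nonneg_left (hmax hy : f y ≤ f x) hs.le
  have htz := mul_le_mul_of_nonneg_left (hmax hz : f z ≤ f x) ht.le
  have h : s * f y + t * f z = f x := by
    rw [← hxyz]; simp
  have hsum : s * f x + t * f x = f x := by rw [← add_mul, hst, one_mul]
  exact huniq y hy (mul_left_cancel₀ hs.ne' (by linarith))

lemma mem_extremePoints_convexHull {S : Set E} {x : E} (hx : x ∈ S) (f : E →L[ℝ] ℝ)
    (h : ∀ y ∈ S, y ≠ x → f y < f x) : x ∈ (convexHull ℝ S).extremePoints ℝ := by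
  have hle : ∀ y ∈ S, f y ≤ f x := fun y hy => by
    rcases eq_or_ne y x with rfl | hne
    · exact le_rfl
    · exact (h y hy hne).le
  refine mem_extremePoints_of_unique_max (f := f) (subset_convexHull ℝ S hx)
    (fun y hy => map_le_of_mem_convexHull f hle hy) fun y hy hyx => ?_
  refine mem_of_map_eq_max f (convex_singleton x) hle (fun s hs hsx => ?_) hy hyx
  by_contra hne
  exact (h s hs hne).ne hsx

lemma IsMaxOn.left_of_add {f : E →L[ℝ] ℝ} {A B : Set E} {y l : E} (hl : l ∈ B)
    (h : IsMaxOn f (A + B) (y + l)) : IsMaxOn f A y := fun z hz => by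
  have := h (add_mem_add hz hl)
  simpa using this

lemma IsMaxOn.right_of_add {f : E →L[ℝ] ℝ} {A B : Set E} {y l : E} (hy : y ∈ A)
    (h : IsMaxOn f (A + B) (y + l)) : IsMaxOn f B l := fun z hz => by
  have := h (add_mem_add hy hz)
  simpa using this

lemma IsMaxOn.add_set {f : E →L[ℝ] ℝ} {A B : Set E} {y l : E} (hy : IsMaxOn f A y)
    (hl : IsMaxOn f B l) : IsMaxOn f (A + B) (y + l) := by
  rintro _ ⟨z, hz, m, hm, rfl⟩
  simpa using add_le_add (hy hz) (hl hm)

/-- If `f` is maximized over `B` only at `l` and `y` is an extreme point of `A` maximizing `f`,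
then `y + l` is an extreme point of `A + B`. -/
lemma add_mem_extremePoints {f : E →L[ℝ] ℝ} {A B : Set E} {y l : E}
    (hy : y ∈ A.extremePoints ℝ) (hl : l ∈ B) (hyf : IsMaxOn f A y) (hlf : IsMaxOn f B l)
    (huniq : ∀ m ∈ B, f m = f l → m = l) : y + l ∈ (A + B).extremePoints ℝ := by
  rw [mem_extremePoints_iff_left] at hy ⊢
  refine ⟨add_mem_add hy.1 hl, ?_⟩
  rintro _ ⟨y₁, hy₁, l₁, hl₁, rfl⟩ _ ⟨y₂, hy₂, l₂, hl₂, rfl⟩ ⟨s, t, hs, ht, hst, h⟩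
  have hf : s * (f y₁ + f l₁) + t * (f y₂ + f l₂) = f y + f l := by
    rw [← map_add f y l, ← h]; simp [mul_add]
  have i₁ := mul_le_mul_of_nonneg_left (hyf hy₁ : f y₁ ≤ f y) hs.le
  have i₂ := mul_le_mul_of_nonneg_left (hyf hy₂ : f y₂ ≤ f y) ht.le
  have i₃ := mul_le_mul_of_nonneg_left (hlf hl₁ : f l₁ ≤ f l) hs.le
  have i₄ := mul_le_mul_of_nonneg_left (hlf hl₂ : f l₂ ≤ f l) ht.le
  have hsy : s * f y + t * f y = f y := by rw [← add_mul, hst, one_mul]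
  have hsl : s * f l + t * f l = f l := by rw [← add_mul, hst, one_mul]
  have e₁ : l₁ = l := huniq l₁ hl₁ (mul_left_cancel₀ hs.ne' (by linarith))
  have e₂ : l₂ = l := huniq l₂ hl₂ (mul_left_cancel₀ ht.ne' (by linarith))
  subst e₁ e₂
  have hy' : y ∈ openSegment ℝ y₁ y₂ := by
    refine ⟨s, t, hs, ht, hst, ?_⟩
    have : (s • y₁ + t • y₂) + (s + t) • l₂ = y + l₂ := by rw [← h]; module
    rwa [hst, one_smul, add_left_inj] at this
  rw [hy.2 y₁ hy₁ y₂ hy₂ hy']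

lemma eq_endpoint_of_isMaxOn_segment {f : E →L[ℝ] ℝ} {a b l : E} (hab : f a ≠ f b)
    (hl : l ∈ segment ℝ a b) (hmax : IsMaxOn f (segment ℝ a b) l) : l = a ∨ l = b := by
  have ha := hmax (left_mem_segment ℝ a b)
  have hb := hmax (right_mem_segment ℝ a b)
  simp only [mem_ofPred_eq] at ha hb
  rw [← convexHull_pair] at hl
  rcases ha.eq_or_lt with h | h
  · left
    refine mem_of_map_eq_max f (convex_singleton a) (M := f a) ?_ ?_ hl h.symm
    · rintro _ (rfl | rfl) <;> linarith
    · rintro _ (rfl | rfl) h'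
      · rfl
      · exact absurd h'.symm hab
  · right
    rcases hb.eq_or_lt with h' | h'
    · refine mem_of_map_eq_max f (convex_singleton b) (M := f b) ?_ ?_ hl h'.symm
      · rintro _ (rfl | rfl) <;> linarith
      · rintro _ (rfl | rfl) h''
        · exact absurd h'' hab
        · rfl
    · have := map_le_of_mem_convexHull f (M := max (f a) (f b))
        (by rintro _ (rfl | rfl) <;> simp) hl
      exact absurd this (not_le.2 (max_lt h h'))

end

/-! ### Lattice polytopes -/

lemma IsLatticePolytope.convex {P : Set V} (hP : IsLatticePolytope P) : Convex ℝ P := by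
  obtain ⟨S, -, rfl⟩ := hP
  exact convex_convexHull ℝ _

lemma IsLatticePolytope.isCompact {P : Set V} (hP : IsLatticePolytope P) : IsCompact P := by
  obtain ⟨S, -, rfl⟩ := hP
  exact (S.finite_toSet.image toR).isCompact_convexHull ℝ

lemma IsLatticePolytope.nonempty {P : Set V} (hP : IsLatticePolytope P) : P.Nonempty := by
  obtain ⟨S, hS, rfl⟩ := hP
  exact (hS.to_set.image toR).convexHull

lemma IsLatticePolytope.mem_latticePoints {P : Set V} (hP : IsLatticePolytope P) {x : V}
    (hx : x ∈ P.extremePoints ℝ) : x ∈ latticePoints := by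
  obtain ⟨S, -, rfl⟩ := hP
  obtain ⟨v, -, rfl⟩ := extremePoints_convexHull_subset hx
  exact ⟨v, rfl⟩

open Classical in
lemma IsLatticePolytope.add {P Q : Set V} (hP : IsLatticePolytope P) (hQ : IsLatticePolytope Q) :
    IsLatticePolytope (P + Q) := by
  obtain ⟨S, hS, rfl⟩ := hP
  obtain ⟨T, hT, rfl⟩ := hQ
  refine ⟨S + T, hS.add hT, ?_⟩
  rw [← convexHull_add, Finset.coe_add]
  congr 1
  exact (image_image2_distrib toR_add).symm

lemma IsLatticePolytope.exists_isMaxOn {P : Set V} (hP : IsLatticePolytope P) (f : V →L[ℝ] ℝ) :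
    ∃ v : ℤ × ℤ, toR v ∈ P ∧ IsMaxOn f P (toR v) := by
  obtain ⟨S, hS, rfl⟩ := hP
  obtain ⟨v, hv, hmax⟩ := S.exists_max_image (fun v => f (toR v)) hS
  refine ⟨v, subset_convexHull ℝ _ ⟨v, hv, rfl⟩, fun y hy => map_le_of_mem_convexHull f ?_ hy⟩
  rintro _ ⟨w, hw, rfl⟩
  exact hmax w hw

lemma isLatticePolytope_segment (a b : ℤ × ℤ) : IsLatticePolytope (segment ℝ (toR a) (toR b)) := by
  classical
  refine ⟨{a, b}, by simp, ?_⟩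
  rw [← convexHull_pair, Finset.coe_pair, image_pair]

lemma eq_endpoint_of_isCoprime {v w z : ℤ × ℤ} (h : IsCoprime (w - v).1 (w - v).2)
    (hz : toR z ∈ segment ℝ (toR v) (toR w)) : z = v ∨ z = w := by
  obtain ⟨r, s, hrs⟩ := h
  rw [segment_eq_image'] at hz
  obtain ⟨t, ⟨ht0, ht1⟩, ht⟩ := hz
  have h₁ : (v.1 : ℝ) + t * (w.1 - v.1) = z.1 := by simpa [toR] using congrArg Prod.fst ht
  have h₂ : (v.2 : ℝ) + t * (w.2 - v.2) = z.2 := by simpa [toR] using congrArg Prod.snd ht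
  have hrs' : (r : ℝ) * (w.1 - v.1) + s * (w.2 - v.2) = 1 := by exact_mod_cast hrs
  have hk : t = ((r * (z.1 - v.1) + s * (z.2 - v.2) : ℤ) : ℝ) := by
    push_cast
    linear_combination -t * hrs' + r * h₁ + s * h₂
  generalize r * (z.1 - v.1) + s * (z.2 - v.2) = k at hk
  subst hk
  have hk0 : 0 ≤ k := by exact_mod_cast ht0
  have hk1 : k ≤ 1 := by exact_mod_cast ht1
  obtain rfl | rfl : k = 0 ∨ k = 1 := by omega
  · left
    refine toR_injective ?_
    rw [← ht]; simp
  · right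
    refine toR_injective ?_
    rw [← ht]; simp

lemma left_mem_extremePoints_segment {a b : V} (hab : a ≠ b) :
    a ∈ (segment ℝ a b).extremePoints ℝ := by
  have hlt : dual (a - b).1 (a - b).2 b < dual (a - b).1 (a - b).2 a := by
    rw [← sub_pos, ← map_sub, dual_apply]
    by_contra! h
    refine hab (sub_eq_zero.1 (Prod.ext ?_ ?_))
    · exact mul_self_eq_zero.1
        (by nlinarith [mul_self_nonneg (a - b).1, mul_self_nonneg (a - b).2])
    · exact mul_self_eq_zero.1
        (by nlinarith [mul_self_nonneg (a - b).1, mul_self_nonneg (a - b).2])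
  rw [← convexHull_pair]
  refine mem_extremePoints_convexHull (by simp) (dual (a - b).1 (a - b).2) ?_
  rintro _ (rfl | rfl) h
  · exact absurd rfl h
  · exact hlt

/-! ### Adding a segment to a toric diagram -/

/-- A lattice point maximizing a nonzero functional over a toric diagram is not in the interior of
a segment of the diagram. -/
lemma IsToricDiagram.eq_left_of_mem_openSegment {P : Set V} (hP : IsToricDiagram P)
    {f : V →L[ℝ] ℝ} (hf : f ≠ 0) {x y z : V} (hx : x ∈ P) (hxl : x ∈ latticePoints)
    (hmax : IsMaxOn f P x) (hy : y ∈ P) (hz : z ∈ P) (h : x ∈ openSegment ℝ y z) : y = x :=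
  (mem_extremePoints_iff_left.1 (hP.2.2 x (mem_frontier_of_isMaxOn hf hx hmax) hxl)).2 y hy z hz h

/-- Let `E` be a set of pairs of lattice points spanning edges of the toric diagram `Q`, containing
an edge in every direction in which a functional has more than one maximizer. Then the sum of `Q`
and a lattice segment is toric iff the segment is primitive and not parallel to any edge in `E`. -/
theorem IsToricDiagram.add_segment_iff {Q : Set V} {E : Set ((ℤ × ℤ) × (ℤ × ℤ))}
    (hQ : IsToricDiagram Q)
    (hE : ∀ e ∈ E, e.1 ≠ e.2 ∧ toR e.1 ∈ Q ∧ toR e.2 ∈ Q ∧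
      ∃ f : V →L[ℝ] ℝ, f ≠ 0 ∧ f (toR e.1) = f (toR e.2) ∧ IsMaxOn f Q (toR e.1))
    (hface : ∀ f : V →L[ℝ] ℝ, f ≠ 0 →
      (∀ y ∈ Q, ∀ z ∈ Q, IsMaxOn f Q y → IsMaxOn f Q z → y = z) ∨
        ∃ e ∈ E, f (toR e.1) = f (toR e.2))
    {a b : ℤ × ℤ} (hab : a ≠ b) :
    IsToricDiagram (Q + segment ℝ (toR a) (toR b)) ↔
      (∀ x ∈ segment ℝ (toR a) (toR b), x ∈ latticePoints → x = toR a ∨ x = toR b) ∧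
        ∀ e ∈ E, ¬ Par (toR (b - a)) (toR (e.2 - e.1)) := by
  set L := segment ℝ (toR a) (toR b) with hL
  have haL : toR a ∈ L := left_mem_segment ..
  have hbL : toR b ∈ L := right_mem_segment ..
  constructor
  · intro hT
    refine ⟨?_, ?_⟩
    · rintro m hmL ⟨m, rfl⟩
      by_contra! hne
      have hd : (b - a).1 ≠ 0 ∨ (b - a).2 ≠ 0 := by
        by_contra! h
        exact hab (sub_eq_zero.1 (Prod.ext h.1 h.2)).symm
      have hf : dual (toR (b - a)).2 (-(toR (b - a)).1) ≠ 0 := by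
        apply dual_ne_zero
        simpa [toR, or_comm, -Prod.snd_sub, -Prod.fst_sub] using hd
      set f := dual (toR (b - a)).2 (-(toR (b - a)).1) with hfdef
      have hfab : f (toR b) - f (toR a) = 0 := by
        rw [← map_sub, ← toR_sub, hfdef, dual_apply]; ring
      have hfL : ∀ l ∈ L, f l = f (toR a) := by
        rintro _ ⟨s, t, -, -, hst, rfl⟩
        simp only [map_add, map_smul, smul_eq_mul]
        linear_combination t * hfab + f (toR a) * hst
      have hmL' : IsMaxOn f L (toR m) := fun l hl => ((hfL l hl).trans (hfL _ hmL).symm).le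
      obtain ⟨v, hv, hvmax⟩ := hQ.1.exists_isMaxOn f
      have h := hT.eq_left_of_mem_openSegment hf (add_mem_add hv hmL) ⟨v + m, toR_add v m⟩
        (hvmax.add_set hmL') (add_mem_add hv haL) (add_mem_add hv hbL)
        ((mem_openSegment_translate ℝ (toR v)).2
          (mem_openSegment_of_ne_left_right hne.1.symm hne.2.symm hmL))
      exact hne.1 (add_left_cancel h).symm
    · rintro e he hpar
      obtain ⟨hne, h₁, h₂, f, hf, hfe, hmax⟩ := hE e he
      have he0 : toR (e.2 - e.1) ≠ 0 := by
        rw [toR_sub]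
        exact sub_ne_zero.2 fun h => hne (toR_injective h).symm
      obtain ⟨k, hk⟩ := hpar.exists_smul_eq he0
      rw [toR_sub, toR_sub] at hk
      have hk0 : k ≠ 0 := by
        rintro rfl
        rw [zero_smul, sub_eq_zero] at hk
        exact hab (toR_injective hk).symm
      have hb : toR b = toR a + k • (toR e.2 - toR e.1) := by rw [← hk]; abel
      have hfab : f (toR b) = f (toR a) := by rw [hb]; simp [hfe]
      have hfL : ∀ l ∈ L, f l = f (toR a) := by
        rintro _ ⟨s, t, -, -, hst, rfl⟩
        simp only [map_add, map_smul, smul_eq_mul]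
        linear_combination t * hfab + f (toR a) * hst
      have hmax' : IsMaxOn f Q (toR e.2) := fun y hy => (hmax hy : f y ≤ _).trans hfe.le
      have hL' : ∀ l ∈ L, IsMaxOn f L l := fun l hl z hz => ((hfL z hz).trans (hfL l hl).symm).le
      rcases hk0.lt_or_gt with hk0 | hk0
      · have h := hT.eq_left_of_mem_openSegment hf (add_mem_add h₂ hbL) ⟨e.2 + b, toR_add _ _⟩
          (hmax'.add_set (hL' _ hbL)) (add_mem_add h₂ haL) (add_mem_add h₁ hbL)
          ⟨1 / (1 - k), -k / (1 - k), by apply div_pos <;> linarith,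
            by apply div_pos <;> linarith, by field_simp [show 1 - k ≠ 0 by linarith]; ring, ?_⟩
        · exact hab (toR_injective (add_left_cancel h))
        · rw [hb]
          match_scalars <;> field_simp [show 1 - k ≠ 0 by linarith] <;> ring
      · have h := hT.eq_left_of_mem_openSegment hf (add_mem_add h₁ hbL) ⟨e.1 + b, toR_add _ _⟩
          (hmax.add_set (hL' _ hbL)) (add_mem_add h₁ haL) (add_mem_add h₂ hbL)
          ⟨1 / (1 + k), k / (1 + k), by apply div_pos <;> linarith,
            by apply div_pos <;> linarith, by field_simp [show 1 + k ≠ 0 by linarith], ?_⟩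
        · exact hab (toR_injective (add_left_cancel h))
        · rw [hb]
          match_scalars <;> field_simp [show 1 + k ≠ 0 by linarith]; ring
  · rintro ⟨hprim, hpar⟩
    refine ⟨hQ.1.add (isLatticePolytope_segment a b), ?_, ?_⟩
    · exact (hQ.2.1.add ⟨_, haL⟩).mono subset_interior_add_left
    rintro x hx ⟨u, rfl⟩
    have hP := hQ.1.add (isLatticePolytope_segment a b)
    have hint : (interior (Q + L)).Nonempty := (hQ.2.1.add ⟨_, haL⟩).mono subset_interior_add_left
    obtain ⟨f, hf, hmax⟩ := exists_isMaxOn_of_mem_frontier hP.convex hint hx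
    obtain ⟨y, hy, l, hl, hyl⟩ := hP.isCompact.isClosed.frontier_subset hx
    change y + l = toR u at hyl
    rw [← hyl] at hmax ⊢
    have hymax := hmax.left_of_add hl
    have hlmax := hmax.right_of_add hy
    by_cases hfab : f (toR a) = f (toR b)
    · have huniq : ∀ z ∈ Q, f z = f y → z = y := by
        rcases hface f hf with h | ⟨e, he, hfe⟩
        · intro z hz hzy
          exact h z hz y hy (fun w hw => (hymax hw : f w ≤ _).trans hzy.ge) hymax
        · refine absurd (par_of_map_eq_zero hf ?_ ?_) (hpar e he)
          · rw [toR_sub, map_sub, hfab, sub_self]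
          · rw [toR_sub, map_sub, hfe, sub_self]
      obtain ⟨v, rfl⟩ := hQ.1.mem_latticePoints (mem_extremePoints_of_unique_max hy hymax huniq)
      have hlu : toR (u - v) = l := by rw [toR_sub, ← hyl, add_sub_cancel_left]
      rw [add_comm (toR v), add_comm Q]
      refine add_mem_extremePoints ?_ hy hlmax hymax huniq
      rcases hprim l hl ⟨u - v, hlu⟩ with rfl | rfl
      · exact left_mem_extremePoints_segment (toR_injective.ne hab)
      · rw [hL, segment_symm]
        exact left_mem_extremePoints_segment (toR_injective.ne hab.symm)
    · have hend : ∀ m ∈ L, f m = f l → m = toR a ∨ m = toR b := fun m hm hml =>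
        eq_endpoint_of_isMaxOn_segment hfab hm fun z hz => (hlmax hz : f z ≤ _).trans hml.ge
      have huniq : ∀ m ∈ L, f m = f l → m = l := by
        intro m hm hml
        rcases hend l hl rfl with rfl | rfl <;> rcases hend m hm hml with rfl | rfl
        · rfl
        · exact absurd hml.symm hfab
        · exact absurd hml hfab
        · rfl
      have hyu : y ∈ latticePoints := by
        rcases hend l hl rfl with rfl | rfl
        · exact ⟨u - a, by rw [toR_sub, ← hyl, add_sub_cancel_right]⟩
        · exact ⟨u - b, by rw [toR_sub, ← hyl, add_sub_cancel_right]⟩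
      exact add_mem_extremePoints (hQ.2.2 y (mem_frontier_of_isMaxOn hf hy hymax) hyu) hl hymax
        hlmax huniq

/-! ### The diagrams `𝒴^{p,q}` -/

/-- The vertices of `𝒴^{p,q}`. -/
def gmswVertices (p q : ℤ) : Set (ℤ × ℤ) := {(0, 0), (1, 0), (p, p), (p - q - 1, p - q)}

/-- The edges of `𝒴^{p,q}`, in counterclockwise order, as pairs of endpoints. -/
def gmswEdges (p q : ℤ) : Set ((ℤ × ℤ) × (ℤ × ℤ)) :=
  {((0, 0), (1, 0)), ((1, 0), (p, p)), ((p, p), (p - q - 1, p - q)), ((p - q - 1, p - q), (0, 0))}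

section GMSW

variable {p q : ℤ}

lemma mem_gmsw {v : ℤ × ℤ} (hv : v ∈ gmswVertices p q) : toR v ∈ GMSW p q :=
  subset_convexHull ℝ _ ⟨v, hv, rfl⟩

lemma gmswEdges_mem {e : (ℤ × ℤ) × (ℤ × ℤ)} (he : e ∈ gmswEdges p q) :
    e.1 ∈ gmswVertices p q ∧ e.2 ∈ gmswVertices p q := by
  rcases he with rfl | rfl | rfl | rfl <;> simp [gmswVertices]

lemma gmswEdges_isCoprime {e : (ℤ × ℤ) × (ℤ × ℤ)} (he : e ∈ gmswEdges p q) :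
    IsCoprime (e.2 - e.1).1 (e.2 - e.1).2 := by
  rcases he with rfl | rfl | rfl | rfl
  · exact ⟨1, 0, by simp⟩
  · exact ⟨-1, 1, by simp⟩
  · exact ⟨-1, 1, by simp; ring⟩
  · exact ⟨1, -1, by simp⟩

lemma isLatticePolytope_gmsw (p q : ℤ) : IsLatticePolytope (GMSW p q) :=
  ⟨{(0, 0), (1, 0), (p, p), (p - q - 1, p - q)}, by simp, by simp [GMSW]⟩

lemma interior_gmsw_nonempty (hp : 0 < p) : (interior (GMSW p q)).Nonempty := by
  rw [GMSW, interior_convexHull_nonempty_iff_affineSpan_eq_top, eq_top_iff]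
  intro z _
  set A := affineSpan ℝ (toR '' {(0, 0), (1, 0), (p, p), (p - q - 1, p - q)})
  have hA : ∀ v ∈ gmswVertices p q, toR v ∈ A := fun v hv =>
    subset_affineSpan ℝ _ (mem_image_of_mem toR hv)
  have h₀ := hA (0, 0) (by simp [gmswVertices])
  have h₁ := A.vsub_mem_direction (hA (1, 0) (by simp [gmswVertices])) h₀
  have h₂ := A.vsub_mem_direction (hA (p, p) (by simp [gmswVertices])) h₀
  have hz := A.vadd_mem_of_mem_direction (A.direction.add_mem
    (A.direction.smul_mem (z.1 - z.2) h₁) (A.direction.smul_mem (z.2 / p) h₂)) h₀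
  have hp' : (p : ℝ) ≠ 0 := by exact_mod_cast hp.ne'
  convert hz using 1
  ext <;> simp [toR, hp']

lemma gmsw_isMaxOn {f : V →L[ℝ] ℝ} {x : V} (h : ∀ v ∈ gmswVertices p q, f (toR v) ≤ f x) :
    IsMaxOn f (GMSW p q) x := fun y hy => by
  refine map_le_of_mem_convexHull f ?_ hy
  rintro _ ⟨v, hv, rfl⟩
  exact h v hv

lemma extremePoints_gmsw (hq : 0 < q) (hpq : q < p) :
    (GMSW p q).extremePoints ℝ = toR '' gmswVertices p q := by
  refine extremePoints_convexHull_subset.antisymm ?_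
  have hq' : (0 : ℝ) < q := by exact_mod_cast hq
  have hpq' : (q : ℝ) < p := by exact_mod_cast hpq
  have key : ∀ v ∈ gmswVertices p q, ∃ f : V →L[ℝ] ℝ,
      ∀ w ∈ gmswVertices p q, w ≠ v → f (toR w) < f (toR v) := by
    rintro v (rfl | rfl | rfl | rfl)
    · refine ⟨dual (-(p - q)) (p - q - 2), ?_⟩
      rintro w (rfl | rfl | rfl | rfl) hw <;> try exact absurd rfl hw
      all_goals simp only [dual_apply, toR]; push_cast; linarith
    · refine ⟨dual p (-p), ?_⟩
      rintro w (rfl | rfl | rfl | rfl) hw <;> try exact absurd rfl hw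
      all_goals simp only [dual_apply, toR]; push_cast; linarith
    · refine ⟨dual (p - q) (q + 2 - p), ?_⟩
      rintro w (rfl | rfl | rfl | rfl) hw <;> try exact absurd rfl hw
      all_goals simp only [dual_apply, toR]; push_cast; linarith
    · refine ⟨dual (-p) p, ?_⟩
      rintro w (rfl | rfl | rfl | rfl) hw <;> try exact absurd rfl hw
      all_goals simp only [dual_apply, toR]; push_cast; linarith
  rintro _ ⟨v, hv, rfl⟩
  obtain ⟨f, hf⟩ := key v hv
  refine mem_extremePoints_convexHull ⟨v, hv, rfl⟩ f ?_
  rintro _ ⟨w, hw, rfl⟩ hne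
  exact hf w hw fun h => hne (congrArg toR h)

lemma gmswEdges_support (hq : 0 < q) (hpq : q < p) {e : (ℤ × ℤ) × (ℤ × ℤ)}
    (he : e ∈ gmswEdges p q) :
    ∃ f : V →L[ℝ] ℝ, f ≠ 0 ∧ f (toR e.1) = f (toR e.2) ∧ IsMaxOn f (GMSW p q) (toR e.1) := by
  have hq' : (0 : ℝ) < q := by exact_mod_cast hq
  have hpq' : (q : ℝ) < p := by exact_mod_cast hpq
  rcases he with rfl | rfl | rfl | rfl
  · refine ⟨dual 0 (-1), dual_ne_zero (by simp), by simp [dual_apply, toR], gmsw_isMaxOn ?_⟩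
    rintro w (rfl | rfl | rfl | rfl) <;> simp only [dual_apply, toR] <;> push_cast <;> linarith
  · refine ⟨dual p (-(p - 1)), dual_ne_zero (.inl (by linarith)), ?_, gmsw_isMaxOn ?_⟩
    · simp only [dual_apply, toR]; push_cast; ring
    rintro w (rfl | rfl | rfl | rfl) <;> simp only [dual_apply, toR] <;> push_cast <;> linarith
  · refine ⟨dual (-q) (q + 1), dual_ne_zero (.inr (by linarith)), ?_, gmsw_isMaxOn ?_⟩
    · simp only [dual_apply, toR]; push_cast; ring
    rintro w (rfl | rfl | rfl | rfl) <;> simp only [dual_apply, toR] <;> push_cast <;> linarith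
  · refine ⟨dual (-(p - q)) (p - q - 1), dual_ne_zero (.inl (by linarith)), ?_, gmsw_isMaxOn ?_⟩
    · simp only [dual_apply, toR]; push_cast; ring
    rintro w (rfl | rfl | rfl | rfl) <;> simp only [dual_apply, toR] <;> push_cast <;> linarith

/-- The maximizers of a nonzero functional over `𝒴^{p,q}` form a vertex or lie on an edge. -/
lemma gmsw_face (hq : 0 < q) (hpq : q < p) {f : V →L[ℝ] ℝ} (hf : f ≠ 0) {M : ℝ}
    (hle : ∀ y ∈ GMSW p q, f y ≤ M) :
    (∃ v ∈ gmswVertices p q, ∀ y ∈ GMSW p q, f y = M → y = toR v) ∨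
      ∃ e ∈ gmswEdges p q, f (toR e.1) = f (toR e.2) ∧
        ∀ y ∈ GMSW p q, f y = M → y ∈ segment ℝ (toR e.1) (toR e.2) := by
  have hq' : (0 : ℝ) < q := by exact_mod_cast hq
  have hpq' : (q : ℝ) < p := by exact_mod_cast hpq
  have h₀ := hle _ (mem_gmsw (v := (0, 0)) (by simp [gmswVertices]))
  have h₁ := hle _ (mem_gmsw (v := (1, 0)) (by simp [gmswVertices]))
  have h₂ := hle _ (mem_gmsw (v := (p, p)) (by simp [gmswVertices]))
  have h₃ := hle _ (mem_gmsw (v := (p - q - 1, p - q)) (by simp [gmswVertices]))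
  have cover : ∀ C : Set V, Convex ℝ C → (f (toR (0, 0)) = M → toR (0, 0) ∈ C) →
      (f (toR (1, 0)) = M → toR (1, 0) ∈ C) → (f (toR (p, p)) = M → toR (p, p) ∈ C) →
      (f (toR (p - q - 1, p - q)) = M → toR (p - q - 1, p - q) ∈ C) →
      ∀ y ∈ GMSW p q, f y = M → y ∈ C := by
    intro C hC c₀ c₁ c₂ c₃ y hy hyM
    refine mem_of_map_eq_max f hC (fun s hs => hle s (subset_convexHull ℝ _ hs)) ?_ hy hyM
    rintro _ ⟨v, rfl | rfl | rfl | rfl, rfl⟩ <;> assumption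
  have n₀₂ : f (toR (0, 0)) = M → f (toR (p, p)) ≠ M := by
    intro e₀ e₂
    rw [clm_apply] at e₀ e₂ h₁ h₃
    simp only [toR] at e₀ e₂ h₁ h₃
    push_cast at e₀ e₂ h₁ h₃
    have hαβ : f (1, 0) + f (0, 1) = 0 :=
      mul_left_cancel₀ (show (p : ℝ) ≠ 0 by linarith) (by linarith)
    have hβ : f (0, 1) = -f (1, 0) := by linarith
    rw [hβ] at h₃
    have hα : f (1, 0) = 0 := le_antisymm (by linarith) (by linarith)
    exact hf (clm_eq_zero hα (by linarith))
  have n₁₃ : f (toR (1, 0)) = M → f (toR (p - q - 1, p - q)) ≠ M := by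
    intro e₁ e₃
    rw [clm_apply] at e₁ e₃ h₀ h₂
    simp only [toR] at e₁ e₃ h₀ h₂
    push_cast at e₁ e₃ h₀ h₂
    have h : ((p : ℝ) - q) * (f (1, 0) + f (0, 1)) = 2 * f (1, 0) := by linarith
    have hα0 : 0 ≤ f (1, 0) := by linarith
    have h' : (p : ℝ) * (2 * f (1, 0)) ≤ (p - q) * f (1, 0) := by
      rw [← h]
      have := mul_le_mul_of_nonneg_left
        (show (p : ℝ) * (f (1, 0) + f (0, 1)) ≤ f (1, 0) by linarith)
        (show (0 : ℝ) ≤ p - q by linarith)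
      linarith
    have hα : f (1, 0) = 0 := by
      by_contra hne
      have := mul_pos (show (0 : ℝ) < p + q by linarith) (lt_of_le_of_ne hα0 (Ne.symm hne))
      linarith
    rw [hα, zero_add, mul_zero] at h
    exact hf (clm_eq_zero hα ((mul_eq_zero.1 h).resolve_left (by linarith)))
  have vertex : ∀ v ∈ gmswVertices p q, (∀ w ∈ gmswVertices p q, f (toR w) = M → w = v) →
      ∃ v ∈ gmswVertices p q, ∀ y ∈ GMSW p q, f y = M → y = toR v := by
    intro v hv h
    refine ⟨v, hv, cover {toR v} (convex_singleton _) ?_ ?_ ?_ ?_⟩ <;>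
    exact fun hw => congrArg toR (h _ (by simp [gmswVertices]) hw)
  have edge : ∀ e ∈ gmswEdges p q, f (toR e.1) = M → f (toR e.2) = M →
      (∀ w ∈ gmswVertices p q, f (toR w) = M → w = e.1 ∨ w = e.2) →
      ∃ e ∈ gmswEdges p q, f (toR e.1) = f (toR e.2) ∧
        ∀ y ∈ GMSW p q, f y = M → y ∈ segment ℝ (toR e.1) (toR e.2) := by
    intro e he e₁ e₂ h
    have hmem : ∀ w ∈ gmswVertices p q, f (toR w) = M → toR w ∈ segment ℝ (toR e.1) (toR e.2) := by
      intro w hw hwM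
      rcases h w hw hwM with rfl | rfl
      · exact left_mem_segment ..
      · exact right_mem_segment ..
    refine ⟨e, he, e₁.trans e₂.symm, cover _ (convex_segment _ _) ?_ ?_ ?_ ?_⟩ <;>
    exact hmem _ (by simp [gmswVertices])
  by_cases c₀ : f (toR (0, 0)) = M
  · have c₂ := n₀₂ c₀
    by_cases c₁ : f (toR (1, 0)) = M
    · have c₃ := n₁₃ c₁
      refine .inr (edge ((0, 0), (1, 0)) (by simp [gmswEdges]) c₀ c₁ ?_)
      rintro w (rfl | rfl | rfl | rfl) hw <;> first | contradiction | simp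
    · by_cases c₃ : f (toR (p - q - 1, p - q)) = M
      · refine .inr (edge ((p - q - 1, p - q), (0, 0)) (by simp [gmswEdges]) c₃ c₀ ?_)
        rintro w (rfl | rfl | rfl | rfl) hw <;> first | contradiction | simp
      · refine .inl (vertex (0, 0) (by simp [gmswVertices]) ?_)
        rintro w (rfl | rfl | rfl | rfl) hw <;> first | contradiction | rfl
  · by_cases c₁ : f (toR (1, 0)) = M
    · have c₃ := n₁₃ c₁
      by_cases c₂ : f (toR (p, p)) = M
      · refine .inr (edge ((1, 0), (p, p)) (by simp [gmswEdges]) c₁ c₂ ?_)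
        rintro w (rfl | rfl | rfl | rfl) hw <;> first | contradiction | simp
      · refine .inl (vertex (1, 0) (by simp [gmswVertices]) ?_)
        rintro w (rfl | rfl | rfl | rfl) hw <;> first | contradiction | rfl
    · by_cases c₂ : f (toR (p, p)) = M
      · by_cases c₃ : f (toR (p - q - 1, p - q)) = M
        · refine .inr (edge ((p, p), (p - q - 1, p - q)) (by simp [gmswEdges]) c₂ c₃ ?_)
          rintro w (rfl | rfl | rfl | rfl) hw <;> first | contradiction | simp
        · refine .inl (vertex (p, p) (by simp [gmswVertices]) ?_)
          rintro w (rfl | rfl | rfl | rfl) hw <;> first | contradiction | rfl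
      · refine .inl (vertex (p - q - 1, p - q) (by simp [gmswVertices]) ?_)
        rintro w (rfl | rfl | rfl | rfl) hw <;> first | contradiction | rfl

lemma isToricDiagram_gmsw (hq : 0 < q) (hpq : q < p) : IsToricDiagram (GMSW p q) := by
  have hP := isLatticePolytope_gmsw p q
  have hint : (interior (GMSW p q)).Nonempty := interior_gmsw_nonempty (hq.trans hpq)
  refine ⟨hP, hint, ?_⟩
  rintro x hx ⟨u, rfl⟩
  have hxP := hP.isCompact.isClosed.frontier_subset hx
  obtain ⟨f, hf, hmax⟩ := exists_isMaxOn_of_mem_frontier hP.convex hint hx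
  rw [extremePoints_gmsw hq hpq]
  rcases gmsw_face hq hpq hf hmax with ⟨v, hv, h⟩ | ⟨e, he, -, h⟩
  · exact ⟨v, hv, (h _ hxP rfl).symm⟩
  · refine mem_image_of_mem toR ?_
    rcases eq_endpoint_of_isCoprime (gmswEdges_isCoprime he) (h _ hxP rfl) with rfl | rfl
    · exact (gmswEdges_mem he).1
    · exact (gmswEdges_mem he).2

lemma ncard_gmswVertices (hq : 0 < q) (hpq : q < p) : (gmswVertices p q).ncard = 4 := by
  have h : gmswVertices p q =
      (({(0, 0), (1, 0), (p, p), (p - q - 1, p - q)} : Finset (ℤ × ℤ)) : Set (ℤ × ℤ)) := by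
    simp [gmswVertices]
  rw [h, ncard_coe_finset, Finset.card_insert_of_notMem, Finset.card_insert_of_notMem,
    Finset.card_insert_of_notMem, Finset.card_singleton]
  all_goals simp only [Finset.mem_insert, Finset.mem_singleton, Prod.mk.injEq]; omega

end GMSW

/-- For `p > q > 0`, `𝒴^{p,q}` is a toric diagram with exactly four extreme
points, and for any lattice segment `L` with endpoints `a ≠ b`, `𝒴^{p,q} + L` is a toric
diagram iff `L` contains no lattice points other than its two endpoints and the edge
vector of `L` is not parallel to any of `(1,0)`, `(p−1,p)`, `(−q−1,−q)`, `(−p+q+1,−p+q)`. -/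
theorem statement13 (p q : ℤ) (hq : 0 < q) (hpq : q < p) :
    IsToricDiagram (GMSW p q) ∧
    ((GMSW p q).extremePoints ℝ).ncard = 4 ∧
    ∀ a b : ℤ × ℤ, a ≠ b →
      (IsToricDiagram (GMSW p q + segment ℝ (toR a) (toR b)) ↔
        ((∀ x ∈ segment ℝ (toR a) (toR b), x ∈ latticePoints → x = toR a ∨ x = toR b) ∧
          ¬ Par (toR (b - a)) (toR (1, 0)) ∧
          ¬ Par (toR (b - a)) (toR (p - 1, p)) ∧
          ¬ Par (toR (b - a)) (toR (-q - 1, -q)) ∧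
          ¬ Par (toR (b - a)) (toR (-p + q + 1, -p + q)))) := by

  have hQ := isToricDiagram_gmsw hq hpq
  refine ⟨hQ, ?_, fun a b hab => ?_⟩
  · rw [extremePoints_gmsw hq hpq, ncard_image_of_injective _ toR_injective,
      ncard_gmswVertices hq hpq]
  rw [hQ.add_segment_iff (E := gmswEdges p q) ?_ ?_ hab]
  · simp only [gmswEdges, forall_mem_insert, mem_singleton_iff, forall_eq, Prod.mk_sub_mk]
    ring_nf
  · intro e he
    refine ⟨fun h => ?_, mem_gmsw (gmswEdges_mem he).1, mem_gmsw (gmswEdges_mem he).2,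
      gmswEdges_support hq hpq he⟩
    simpa [h, isCoprime_zero_left] using gmswEdges_isCoprime he
  · intro f hf
    obtain ⟨v, hv, hmax⟩ := hQ.1.exists_isMaxOn f
    rcases gmsw_face hq hpq hf hmax with ⟨w, -, h⟩ | ⟨e, he, hfe, -⟩
    · refine .inl fun y hy z hz hymax hzmax => ?_
      rw [h y hy (le_antisymm (hmax hy) (hymax hv)), h z hz (le_antisymm (hmax hz) (hzmax hv))]
    · exact .inr ⟨e, he, hfe⟩
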